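/- arXiv:2202.08574 — 2 statements merged into one kernel-verified Lean document; each statement's English description precedes it below -/
import Mathlib

section
/- In a bipartite graph G, the maximum size of a matching equals the minimum size of a vertex cover (König's theorem). -/
open SimpleGraph

def IsIndepSet' {V : Type*} (G : SimpleGraph V) (s : Finset V) : Prop :=
  ∀ u ∈ s, ∀ v ∈ s, ¬ G.Adj u v

noncomputable def alpha' {V : Type*} (G : SimpleGraph V) : ℕ :=
  sSup {n | ∃ s : Finset V, IsIndepSet' G s ∧ s.card = n}

def IsVC' {V : Type*} (G : SimpleGraph V) (s : Finset V) : Prop :=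
  ∀ ⦃u v : V⦄, G.Adj u v → u ∈ s ∨ v ∈ s

noncomputable def tau' {V : Type*} (G : SimpleGraph V) : ℕ :=
  sInf {n | ∃ s : Finset V, IsVC' G s ∧ s.card = n}

def IsMatching' {V : Type*} (G : SimpleGraph V) (M : Finset (Sym2 V)) : Prop :=
  (↑M : Set (Sym2 V)) ⊆ G.edgeSet ∧
    (↑M : Set (Sym2 V)).Pairwise fun e f => ∀ v : V, v ∈ e → v ∉ f

noncomputable def mu' {V : Type*} (G : SimpleGraph V) : ℕ :=
  sSup {n | ∃ M : Finset (Sym2 V), IsMatching' G M ∧ M.card = n}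

noncomputable def omega' {V : Type*} (G : SimpleGraph V) : ℕ :=
  sSup {n | ∃ s : Finset V, G.IsClique (↑s : Set V) ∧ s.card = n}

def IsBipartite' {V : Type*} (G : SimpleGraph V) : Prop :=
  ∃ A : Set V, ∀ ⦃u v : V⦄, G.Adj u v → (u ∈ A ↔ v ∉ A)

/-- The contraction `G/S`: vertices are the connected components of the spanning
subgraph `(V(G), S)`, two components adjacent iff they contain adjacent vertices of `G`. -/
noncomputable def contract' {V : Type*} (G : SimpleGraph V) (S : Set (Sym2 V)) :
    SimpleGraph (SimpleGraph.fromEdgeSet S).ConnectedComponent :=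
  SimpleGraph.fromRel fun A B => ∃ u v : V,
    (SimpleGraph.fromEdgeSet S).connectedComponentMk u = A ∧
    (SimpleGraph.fromEdgeSet S).connectedComponentMk v = B ∧ G.Adj u v

/-- Add a universal vertex `none` to `G`. -/
def addUniversal {V : Type*} (G : SimpleGraph V) : SimpleGraph (Option V) :=
  SimpleGraph.fromRel fun a b =>
    a = none ∨ ∃ u v : V, a = some u ∧ b = some v ∧ G.Adj u v

open Classical in
/-- The neighbours of `v` outside `C`. -/
noncomputable def outN {V : Type*} [Fintype V] (G : SimpleGraph V) (C : Finset V) (v : V) :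
    Finset V := Finset.univ.filter fun w => G.Adj v w ∧ w ∉ C

open Classical in
theorem konig_half {V : Type*} [Fintype V] (G : SimpleGraph V) (C : Finset V)
    (hC : IsVC' G C) (hmin : ∀ D, IsVC' G D → C.card ≤ D.card)
    (S : Finset V) (hS : S ⊆ C) (hind : ∀ u ∈ S, ∀ v ∈ S, ¬ G.Adj u v) :
    S.card ≤ (S.biUnion (outN G C)).card := by
  have h1 : IsVC' G ((C \ S) ∪ S.biUnion (outN G C)) := by
    intro u v huv
    have h := hC huv
    have a := hind u
    have b := hind v
    have hvu := huv.symm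
    simp only [Finset.mem_union, Finset.mem_sdiff, Finset.mem_biUnion, outN, Finset.mem_filter,
      Finset.mem_univ, true_and]
    by_cases hu : u ∈ S
    · have := a hu v
      by_cases hv : v ∈ C
      · exact Or.inr (Or.inl ⟨hv, fun h => this h huv⟩)
      · exact Or.inr (Or.inr ⟨u, hu, huv, hv⟩)
    · by_cases hu' : u ∈ C
      · exact Or.inl (Or.inl ⟨hu', hu⟩)
      · by_cases hv : v ∈ S
        · exact Or.inl (Or.inr ⟨v, hv, hvu, hu'⟩)
        · exact Or.inr (Or.inl ⟨h.resolve_left hu', hv⟩)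
  have h2 := hmin _ h1
  have h3 := Finset.card_union_le (C \ S) (S.biUnion (outN G C))
  have h4 := Finset.card_sdiff_add_card_eq_card hS
  omega

open Classical in
theorem konig_weak {V : Type*} (G : SimpleGraph V) (M : Finset (Sym2 V)) (C : Finset V)
    (hM : IsMatching' G M) (hC : IsVC' G C) : M.card ≤ C.card := by
  have h : ∀ e : Sym2 V, e ∈ M → ∃ v ∈ C, v ∈ e := by
    intro e he
    have := hM.1 he
    induction e with
    | _ u v =>
      rcases hC (G.mem_edgeSet.1 this) with h | h
      · exact ⟨u, h, by simp⟩
      · exact ⟨v, h, by simp⟩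
  choose f hf1 hf2 using h
  refine Finset.card_le_card_of_injOn (fun e => if he : e ∈ M then f e he else e.out.1) ?_ ?_
  · intro e he
    have he' : e ∈ M := he
    simp [he', hf1]
  · intro e he e' he' hee
    have h1 : e ∈ M := he
    have h2 : e' ∈ M := he'
    simp only [h1, h2, dif_pos] at hee
    by_contra hne
    exact hM.2 he he' hne _ (hf2 e h1) (hee ▸ hf2 e' h2)

open Classical in
theorem konig_strong {V : Type*} [Fintype V] (G : SimpleGraph V) (hG : IsBipartite' G)
    (C : Finset V) (hC : IsVC' G C) (hmin : ∀ D, IsVC' G D → C.card ≤ D.card) :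
    ∃ M : Finset (Sym2 V), IsMatching' G M ∧ M.card = C.card := by
  obtain ⟨A, hA⟩ := hG
  have hall : ∀ S : Finset V, S ⊆ C → S.card ≤ (S.biUnion (outN G C)).card := by
    intro S hS
    have h1 := konig_half G C hC hmin (S.filter (· ∈ A)) ((Finset.filter_subset _ _).trans hS)
      (by intro u hu v hv huv
          have := hA huv
          simp_all)
    have h2 := konig_half G C hC hmin (S.filter (· ∉ A)) ((Finset.filter_subset _ _).trans hS)
      (by intro u hu v hv huv
          have := hA huv
          simp_all)
    have h3 := Finset.card_filter_add_card_filter_not (s := S) (· ∈ A)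
    have h4 : Disjoint ((S.filter (· ∈ A)).biUnion (outN G C))
        ((S.filter (· ∉ A)).biUnion (outN G C)) := by
      rw [Finset.disjoint_left]
      intro x hx hy
      simp only [Finset.mem_biUnion, Finset.mem_filter, outN, Finset.mem_univ, true_and] at hx hy
      obtain ⟨a, ⟨_, ha⟩, hax, _⟩ := hx
      obtain ⟨b, ⟨_, hb⟩, hbx, _⟩ := hy
      have := hA hax
      have := hA hbx
      tauto
    have h5 := Finset.card_union_of_disjoint h4
    rw [← Finset.union_biUnion, Finset.filter_union_filter_not_eq] at h5
    omega
  obtain ⟨f, hf, hft⟩ := (Finset.all_card_le_biUnion_card_iff_exists_injective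
    (fun v : C => outN G C v)).1 (by
      intro s
      have := hall (s.map (Function.Embedding.subtype _)) (by
        intro x hx
        simp only [Finset.mem_map] at hx
        obtain ⟨y, _, rfl⟩ := hx
        exact y.2)
      rw [Finset.card_map] at this
      refine this.trans (Finset.card_le_card ?_)
      intro x hx
      simp only [Finset.mem_biUnion, Finset.mem_map] at hx ⊢
      obtain ⟨_, ⟨y, hy, rfl⟩, hxy⟩ := hx
      exact ⟨y, hy, hxy⟩)
  have hadj : ∀ v : C, G.Adj v (f v) ∧ f v ∉ C := by
    intro v
    simpa [outN] using hft v
  have key : ∀ v w : C, ∀ x : V, x ∈ s((v : V), f v) → x ∈ s((w : V), f w) → v = w := by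
    intro v w x hx hy
    rw [Sym2.mem_iff] at hx hy
    rcases hx with rfl | rfl <;> rcases hy with hy | hy
    · exact Subtype.ext hy
    · exact absurd (hy ▸ v.2) (hadj w).2
    · exact absurd (hy ▸ w.2) (hadj v).2
    · exact hf hy
  refine ⟨Finset.univ.image fun v : C => s((v : V), f v), ⟨?_, ?_⟩, ?_⟩
  · intro e he
    simp only [Finset.coe_image, Set.mem_image] at he
    obtain ⟨v, _, rfl⟩ := he
    exact (hadj v).1
  · intro e he e' he' hne x hx hy
    simp only [Finset.coe_image, Set.mem_image] at he he'
    obtain ⟨v, _, rfl⟩ := he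
    obtain ⟨w, _, rfl⟩ := he'
    exact hne (by rw [key v w x hx hy])
  · rw [Finset.card_image_of_injective]
    · simp
    · intro v w h
      have h : s((v : V), f v) = s((w : V), f w) := h
      exact key v w v (by simp) (h ▸ by simp)

theorem stmt2 {V : Type*} [Fintype V] (G : SimpleGraph V) (hG : IsBipartite' G) :
    mu' G = tau' G := by
  have hne : {n | ∃ s : Finset V, IsVC' G s ∧ s.card = n}.Nonempty :=
    ⟨_, Finset.univ, fun u v _ => Or.inl (Finset.mem_univ u), rfl⟩
  obtain ⟨C, hC, hcard⟩ := Nat.sInf_mem hne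
  have hmin : ∀ D, IsVC' G D → C.card ≤ D.card := fun D hD => by
    rw [hcard]
    exact Nat.sInf_le ⟨D, hD, rfl⟩
  obtain ⟨M, hM, hMC⟩ := konig_strong G hG C hC hmin
  have hub : ∀ n ∈ {n | ∃ M : Finset (Sym2 V), IsMatching' G M ∧ M.card = n}, n ≤ C.card := by
    rintro n ⟨M', hM', rfl⟩
    exact konig_weak G M' C hM' hC
  have hg : IsGreatest {n | ∃ M : Finset (Sym2 V), IsMatching' G M ∧ M.card = n} C.card :=
    ⟨⟨M, hM, hMC⟩, hub⟩
  unfold mu' tau'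
  rw [hg.csSup_eq, hcard]
end

section
/- Let G be a graph consisting of a clique K_C = {v_c : c ∈ C} together with, for each x in a finite set X, a clique K_x of size 2k+1 plus a vertex v_x complete to K_x, where each v_c is complete to K_x ∪ K_y for its associated pair (x, y); there are no other edges. Then α(G) = |X| + 1. -/
open SimpleGraph

/-- The graph of the chordal reduction: for each variable `x` a clique `K_x` of size
`2k+1` (vertices `Sum.inl (x, i)`) plus a vertex `v_x = Sum.inr (Sum.inl x)` complete to
`K_x`; a clique on the clause vertices `v_c = Sum.inr (Sum.inr c)`, each `v_c` complete
to `K_x ∪ K_y` for its pair `p c = (x, y)`; no other edges. -/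
def redGraph (X C : Type*) (k : ℕ) (p : C → X × X) :
    SimpleGraph ((X × Fin (2 * k + 1)) ⊕ (X ⊕ C)) :=
  SimpleGraph.fromRel fun a b =>
    match a, b with
    | Sum.inl (x, _), Sum.inl (y, _) => x = y
    | Sum.inr (Sum.inl x), Sum.inl (y, _) => x = y
    | Sum.inr (Sum.inr c), Sum.inl (y, _) => y = (p c).1 ∨ y = (p c).2
    | Sum.inr (Sum.inr _), Sum.inr (Sum.inr _) => True
    | _, _ => False

theorem stmt19 {X C : Type*} [Fintype X] [Fintype C] [Nonempty X] [Nonempty C]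
    (k : ℕ) (p : C → X × X) :
    alpha' (redGraph X C k p) = Fintype.card X + 1 := by
  classical
  have hg : IsGreatest {n | ∃ s : Finset ((X × Fin (2 * k + 1)) ⊕ (X ⊕ C)),
      IsIndepSet' (redGraph X C k p) s ∧ s.card = n} (Fintype.card X + 1) := by
    constructor
    · obtain ⟨c⟩ := ‹Nonempty C›
      let g : Option X → (X × Fin (2 * k + 1)) ⊕ (X ⊕ C) := fun o =>
        match o with
        | none => Sum.inr (Sum.inr c)
        | some x => Sum.inr (Sum.inl x)
      have hinj : Function.Injective g := by
        rintro (_ | a) (_ | b) h <;> simp_all [g]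
      refine ⟨Finset.univ.image g, ?_, ?_⟩
      · intro u hu v hv
        simp only [Finset.mem_image, Finset.mem_univ, true_and] at hu hv
        obtain ⟨a, rfl⟩ := hu
        obtain ⟨b, rfl⟩ := hv
        rcases a with _ | a <;> rcases b with _ | b <;> simp [g, redGraph]
      · rw [Finset.card_image_of_injective _ hinj, Finset.card_univ, Fintype.card_option]
    · rintro n ⟨s, hs, rfl⟩
      let f : (X × Fin (2 * k + 1)) ⊕ (X ⊕ C) → Option X := fun v =>
        match v with
        | Sum.inl (x, _) => some x
        | Sum.inr (Sum.inl x) => some x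
        | Sum.inr (Sum.inr _) => none
      rw [← Fintype.card_option, ← Finset.card_univ]
      refine Finset.card_le_card_of_injOn f (fun _ _ => Finset.mem_coe.2 (Finset.mem_univ _)) ?_
      intro u hu v hv h
      have h1 := hs u hu v hv
      by_contra hne
      apply h1
      simp only [redGraph, SimpleGraph.fromRel_adj]
      refine ⟨hne, ?_⟩
      rcases u with ⟨x, i⟩ | x | c <;> rcases v with ⟨y, j⟩ | y | d <;> simp_all [f]
  exact hg.csSup_eq
end
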